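/- For every integer m ≥ 1 there exists an uncountable family of functions φ : ℝ → ℝ such that each φ is real-analytic on ℝ, transcendental (i.e., the only polynomial P ∈ ℂ[x,y] with P(x, φ(x)) = 0 for all real x is the zero polynomial), and maps every m-ultra number to a Liouville number. -/

import Mathlib

open Polynomial

/-- The primitive minimal polynomial over ℤ of a real number. -/
noncomputable def intMinpoly (α : ℝ) : Polynomial ℤ :=
  (IsLocalization.integerNormalization (nonZeroDivisors ℤ) (minpoly ℚ α)).primPart

/-- The height of an algebraic number: the maximum of the absolute values of the
coefficients of its primitive minimal polynomial over ℤ. -/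
noncomputable def algHeight (α : ℝ) : ℕ :=
  (intMinpoly α).support.sup fun i => ((intMinpoly α).coeff i).natAbs

/-- `α` is a real algebraic number of degree exactly `m`. -/
def DegreeExactly (m : ℕ) (α : ℝ) : Prop :=
  IsAlgebraic ℚ α ∧ (minpoly ℚ α).natDegree = m

/-- `exp^[3](x) = e^(e^(e^x))`. -/
noncomputable def expCube (x : ℝ) : ℝ := Real.exp (Real.exp (Real.exp x))

/-- `ξ` is an `m`-ultra number: there is a sequence `(α_n)_{n ≥ 1}` of pairwise distinct
real algebraic numbers of degree exactly `m` with
`0 < |ξ - α_n| < (exp^[3](H(α_n)))^{-n}` for all `n ≥ 1`. Here `a k` plays the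
role of `α_{k+1}`. -/
def IsMUltra (m : ℕ) (ξ : ℝ) : Prop :=
  ∃ a : ℕ → ℝ, Function.Injective a ∧
    ∀ n : ℕ, DegreeExactly m (a n) ∧ 0 < |ξ - a n| ∧
      |ξ - a n| < (expCube (algHeight (a n)))⁻¹ ^ (n + 1)

/-- A function `f : ℝ → ℝ` is transcendental if the only complex two-variable polynomial
`P` with `P (x, f x) = 0` for all real `x` is the zero polynomial. -/
def TranscendentalFun (f : ℝ → ℝ) : Prop :=
  ∀ P : MvPolynomial (Fin 2) ℂ,
    (∀ x : ℝ, MvPolynomial.eval ![(x : ℂ), (f x : ℂ)] P = 0) → P = 0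

/-- The real algebraic numbers of degree at most `m`. -/
def algSet (m : ℕ) : Set ℝ := {α | IsAlgebraic ℚ α ∧ (minpoly ℚ α).natDegree ≤ m}

theorem IsAlgebraic.normalizedMinpoly_ne_zero {α : ℝ} (h : IsAlgebraic ℚ α) :
    IsLocalization.integerNormalization (nonZeroDivisors ℤ) (minpoly ℚ α) ≠ 0 := by
  rw [Ne, IsFractionRing.integerNormalization_eq_zero_iff]
  exact minpoly.ne_zero h.isIntegral

theorem intMinpoly_ne_zero (α : ℝ) : intMinpoly α ≠ 0 :=
  primPart_ne_zero _

theorem aeval_intMinpoly {α : ℝ} (h : IsAlgebraic ℚ α) : aeval α (intMinpoly α) = 0 :=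
  aeval_primPart_eq_zero h.normalizedMinpoly_ne_zero
    (IsLocalization.integerNormalization_aeval_eq_zero _ _ (minpoly.aeval ℚ α))

theorem natDegree_intMinpoly_le (α : ℝ) :
    (intMinpoly α).natDegree ≤ (minpoly ℚ α).natDegree := by
  rw [intMinpoly, natDegree_primPart]
  exact natDegree_le_natDegree
    (Finset.max_mono (IsLocalization.integerNormalization_support _ _))

theorem natAbs_coeff_intMinpoly_le (α : ℝ) (i : ℕ) :
    ((intMinpoly α).coeff i).natAbs ≤ algHeight α := by
  by_cases hi : i ∈ (intMinpoly α).support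
  · exact Finset.le_sup (f := fun i => ((intMinpoly α).coeff i).natAbs) hi
  · simp [notMem_support_iff.mp hi]

theorem one_le_abs_leadingCoeff_intMinpoly (α : ℝ) :
    (1 : ℝ) ≤ |((intMinpoly α).leadingCoeff : ℝ)| := by
  exact_mod_cast Int.one_le_abs (leadingCoeff_ne_zero.mpr (intMinpoly_ne_zero α))

theorem abs_leadingCoeff_intMinpoly_le (α : ℝ) :
    |((intMinpoly α).leadingCoeff : ℝ)| ≤ algHeight α := by
  have := natAbs_coeff_intMinpoly_le α (intMinpoly α).natDegree
  rw [← Int.cast_abs, Int.abs_eq_natAbs]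
  exact_mod_cast this

theorem one_le_algHeight (α : ℝ) : (1 : ℝ) ≤ algHeight α :=
  (one_le_abs_leadingCoeff_intMinpoly α).trans (abs_leadingCoeff_intMinpoly_le α)

/-- Cauchy's bound for the complex conjugates of an algebraic number. -/
theorem norm_le_of_aeval_intMinpoly {α : ℝ} {z : ℂ} (hz : aeval z (intMinpoly α) = 0) :
    ‖z‖ ≤ algHeight α + 1 := by
  set p := (intMinpoly α).map (algebraMap ℤ ℂ) with hp
  have inj : Function.Injective (algebraMap ℤ ℂ) := (algebraMap ℤ ℂ).injective_int
  have hp0 : p ≠ 0 := (Polynomial.map_ne_zero_iff inj).mpr (intMinpoly_ne_zero α)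
  have hroot : p.IsRoot z := by rwa [IsRoot, hp, eval_map_algebraMap]
  have hlt : ‖z‖₊ < p.cauchyBound := hroot.norm_lt_cauchyBound hp0
  have hbound : p.cauchyBound ≤ (algHeight α : NNReal) + 1 := by
    rw [cauchyBound]
    gcongr
    have hlead : 1 ≤ ‖p.leadingCoeff‖₊ := by
      rw [← NNReal.coe_le_coe, hp, leadingCoeff_map_of_injective inj]
      simpa [Int.norm_eq_abs] using one_le_abs_leadingCoeff_intMinpoly α
    refine (div_le_self zero_le hlead).trans (Finset.sup_le fun i _ => ?_)
    rw [hp, coeff_map, ← NNReal.coe_le_coe]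
    have := natAbs_coeff_intMinpoly_le α i
    have h2 : (|(intMinpoly α).coeff i| : ℝ) ≤ algHeight α := by
      rw [← Int.cast_abs, Int.abs_eq_natAbs]
      exact_mod_cast this
    simpa [Int.norm_eq_abs] using h2
  exact_mod_cast (hlt.le.trans hbound)

theorem abs_le_algHeight_add_one {α : ℝ} (h : IsAlgebraic ℚ α) : |α| ≤ algHeight α + 1 := by
  have hz : aeval (α : ℂ) (intMinpoly α) = 0 := by
    have := aeval_algebraMap_apply ℂ α (intMinpoly α)
    rw [aeval_intMinpoly h, map_zero] at this
    exact this
  simpa using norm_le_of_aeval_intMinpoly hz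

open IntermediateField in
/-- Distinct algebraic numbers of bounded degree and height are separated. -/
theorem one_le_abs_sub_mul_pow {m H : ℕ} {α β : ℝ} (hα : α ∈ algSet m) (hβ : β ∈ algSet m)
    (hne : α ≠ β) (hHα : algHeight α ≤ H) (hHβ : algHeight β ≤ H) :
    1 ≤ |α - β| * (2 * (H : ℝ) + 2) ^ (3 * (m ^ 2 + 1)) := by
  obtain ⟨hαa, hαd⟩ := hα
  obtain ⟨hβa, hβd⟩ := hβ
  have hαi : IsIntegral ℚ α := hαa.isIntegral
  have hβi : IsIntegral ℚ β := hβa.isIntegral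
  have : FiniteDimensional ℚ ℚ⟮α⟯ := adjoin.finiteDimensional hαi
  have : FiniteDimensional ℚ ℚ⟮β⟯ := adjoin.finiteDimensional hβi
  let K : IntermediateField ℚ ℝ := ℚ⟮α⟯ ⊔ ℚ⟮β⟯
  have : FiniteDimensional ℚ K := finiteDimensional_sup _ _
  have hdim : Module.finrank ℚ K ≤ m ^ 2 := by
    refine (finrank_sup_le _ _).trans ?_
    rw [adjoin.finrank hαi, adjoin.finrank hβi, sq]
    gcongr
  let x : K := ⟨α, (le_sup_left : ℚ⟮α⟯ ≤ K) (mem_adjoin_simple_self ℚ α)⟩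
  let y : K := ⟨β, (le_sup_right : ℚ⟮β⟯ ≤ K) (mem_adjoin_simple_self ℚ β)⟩
  let p := intMinpoly α
  let q := intMinpoly β
  have hx : aeval x p = 0 := by
    apply (algebraMap K ℝ).injective
    rw [← aeval_algebraMap_apply, map_zero]
    exact aeval_intMinpoly hαa
  have hy : aeval y q = 0 := by
    apply (algebraMap K ℝ).injective
    rw [← aeval_algebraMap_apply, map_zero]
    exact aeval_intMinpoly hβa
  let θ : K := q.leadingCoeff • (p.leadingCoeff • x) - p.leadingCoeff • (q.leadingCoeff • y)
  have hθi : IsIntegral ℤ θ :=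
    ((isIntegral_leadingCoeff_smul p x hx).smul _).sub
      ((isIntegral_leadingCoeff_smul q y hy).smul _)
  have hθ : θ = (p.leadingCoeff * q.leadingCoeff : ℤ) * (x - y) := by
    simp only [θ, zsmul_eq_mul]
    push_cast
    ring
  have hxy : x ≠ y := fun h => hne (congrArg Subtype.val h)
  have hθ0 : θ ≠ 0 := by
    rw [hθ]
    refine mul_ne_zero (Int.cast_ne_zero.mpr (mul_ne_zero ?_ ?_)) (sub_ne_zero.mpr hxy)
    · exact leadingCoeff_ne_zero.mpr (intMinpoly_ne_zero α)
    · exact leadingCoeff_ne_zero.mpr (intMinpoly_ne_zero β)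
  have hHp : |(p.leadingCoeff : ℝ)| ≤ H :=
    (abs_leadingCoeff_intMinpoly_le α).trans (by exact_mod_cast hHα)
  have hHq : |(q.leadingCoeff : ℝ)| ≤ H :=
    (abs_leadingCoeff_intMinpoly_le β).trans (by exact_mod_cast hHβ)
  have hH1 : (1 : ℝ) ≤ H := (one_le_algHeight α).trans (by exact_mod_cast hHα)
  set T : ℝ := 2 * H + 2 with hT
  have hT1 : 1 ≤ T := by linarith
  have hnorm : (1 : ℝ) ≤ ∏ σ : K →ₐ[ℚ] ℂ, ‖σ θ‖ := by
    obtain ⟨z, hz⟩ := IsIntegrallyClosed.isIntegral_iff.mp (Algebra.isIntegral_norm ℚ hθi)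
    have hz0 : z ≠ 0 := by
      rintro rfl
      rw [map_zero, eq_comm, Algebra.norm_eq_zero_iff] at hz
      exact hθ0 hz
    rw [← norm_prod, ← Algebra.norm_eq_prod_embeddings ℚ ℂ θ, ← hz]
    simpa using (by exact_mod_cast Int.one_le_abs hz0 : (1 : ℝ) ≤ |(z : ℝ)|)
  have hconj : ∀ σ : K →ₐ[ℚ] ℂ, ‖σ θ‖ ≤ T ^ 3 := by
    intro σ
    have hσ : ∀ (w : K) (r : ℤ[X]), aeval w r = 0 → aeval (σ w) r = 0 := by
      intro w r hr
      have := aeval_algHom_apply (σ.restrictScalars ℤ) w r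
      rw [hr, map_zero] at this
      exact this
    have h1 : ‖σ x‖ ≤ H + 1 :=
      (norm_le_of_aeval_intMinpoly (hσ x p hx)).trans (by gcongr)
    have h2 : ‖σ y‖ ≤ H + 1 :=
      (norm_le_of_aeval_intMinpoly (hσ y q hy)).trans (by gcongr)
    have h3 : ‖σ x - σ y‖ ≤ T := (norm_sub_le _ _).trans (by linarith)
    rw [hθ, map_mul, map_sub, map_intCast, norm_mul, Complex.norm_intCast]
    push_cast
    rw [abs_mul]
    calc |(p.leadingCoeff : ℝ)| * |(q.leadingCoeff : ℝ)| * ‖σ x - σ y‖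
        ≤ T * T * T := by gcongr <;> linarith
      _ = T ^ 3 := by ring
  let σ₀ : K →ₐ[ℚ] ℂ := (Complex.ofRealAm.restrictScalars ℚ).comp K.val
  have hσ₀ : ‖σ₀ θ‖ ≤ |α - β| * T ^ 3 := by
    have h1 : σ₀ θ = ((p.leadingCoeff * q.leadingCoeff * (α - β) : ℝ) : ℂ) := by
      rw [hθ, map_mul, map_sub, map_intCast]
      have e1 : σ₀ x = (α : ℂ) := rfl
      have e2 : σ₀ y = (β : ℂ) := rfl
      rw [e1, e2]
      push_cast
      ring
    rw [h1, Complex.norm_real, Real.norm_eq_abs, abs_mul, abs_mul]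
    calc |(p.leadingCoeff : ℝ)| * |(q.leadingCoeff : ℝ)| * |α - β|
        ≤ T * T * |α - β| := by gcongr <;> linarith
      _ = |α - β| * T ^ 2 := by ring
      _ ≤ |α - β| * T ^ 3 := by gcongr; norm_num
  classical
  calc (1 : ℝ) ≤ ∏ σ : K →ₐ[ℚ] ℂ, ‖σ θ‖ := hnorm
    _ = ‖σ₀ θ‖ * ∏ σ ∈ Finset.univ.erase σ₀, ‖σ θ‖ :=
        (Finset.mul_prod_erase _ _ (Finset.mem_univ σ₀)).symm
    _ ≤ |α - β| * T ^ 3 * (T ^ 3) ^ (m ^ 2) := by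
        gcongr
        refine (Finset.prod_le_prod (fun σ _ => norm_nonneg _) fun σ _ => hconj σ).trans ?_
        rw [Finset.prod_const]
        refine pow_le_pow_right₀ (one_le_pow₀ hT1) ?_
        refine (Finset.card_le_univ _).trans ?_
        rwa [AlgHom.card]
    _ = |α - β| * T ^ (3 * (m ^ 2 + 1)) := by
        rw [← pow_mul, mul_assoc, ← pow_add]
        congr 2
        ring

/-- There are at most `m * (2 * H + 1) ^ (m + 1)` real algebraic numbers of degree at most `m`
and height at most `H`. -/
theorem exists_finset_algSet (m H : ℕ) : ∃ s : Finset ℝ,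
    (∀ α ∈ algSet m, algHeight α ≤ H → α ∈ s) ∧ s.card ≤ (2 * H + 1) ^ (m + 1) * m := by
  classical
  let I : Finset (Fin (m + 1) → ℤ) := Fintype.piFinset fun _ => Finset.Icc (-(H : ℤ)) H
  let P : (Fin (m + 1) → ℤ) → ℝ[X] := fun c =>
    ∑ i : Fin (m + 1), Polynomial.C (c i : ℝ) * X ^ (i : ℕ)
  refine ⟨I.biUnion fun c => (P c).roots.toFinset, ?_, ?_⟩
  · rintro α ⟨hα, hd⟩ hH
    refine Finset.mem_biUnion.mpr ⟨fun i => (intMinpoly α).coeff i, ?_, ?_⟩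
    · refine Fintype.mem_piFinset.mpr fun i => Finset.mem_Icc.mpr ?_
      have := natAbs_coeff_intMinpoly_le α i
      omega
    · have hP : P (fun i => (intMinpoly α).coeff i) = (intMinpoly α).map (algebraMap ℤ ℝ) := by
        rw [as_sum_range_C_mul_X_pow' ((intMinpoly α).map (algebraMap ℤ ℝ))
          (n := m + 1), Finset.sum_range]
        · simp [P]
        · exact Nat.lt_succ_of_le
            ((natDegree_map_le).trans ((natDegree_intMinpoly_le α).trans hd))
      rw [hP, Multiset.mem_toFinset, mem_roots', IsRoot, eval_map_algebraMap]
      exact ⟨(Polynomial.map_ne_zero_iff (algebraMap ℤ ℝ).injective_int).mpr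
        (intMinpoly_ne_zero α), aeval_intMinpoly hα⟩
  · refine (Finset.card_biUnion_le_card_mul _ _ m fun c _ => ?_).trans ?_
    · refine (Multiset.toFinset_card_le _).trans ((card_roots' _).trans ?_)
      refine natDegree_sum_le_of_forall_le _ _ fun i _ => ?_
      exact (natDegree_C_mul_X_pow_le _ _).trans (Nat.lt_succ_iff.mp i.2)
    · gcongr
      rw [Fintype.card_piFinset_const]
      simp only [Int.card_Icc]
      exact Nat.pow_le_pow_left (by omega) _
open Filter Topology

/-- A real function growing faster than every polynomial is transcendental. -/
theorem transcendentalFun_of_growth {f : ℝ → ℝ} (hf : ∀ N : ℕ, ∀ᶠ x in atTop, x ^ N ≤ f x) :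
    TranscendentalFun f := by
  intro P hP
  by_contra hP0
  obtain ⟨d₀, hd₀, hmax⟩ := Finset.exists_max_image P.support
    (fun d => toLex (d 1, d 0)) (MvPolynomial.support_nonempty.mpr hP0)
  set mon : (Fin 2 →₀ ℕ) → ℝ → ℝ := fun d x => x ^ d 0 * f x ^ d 1 with hmon
  have hdom : ∀ d ∈ P.support.erase d₀, ∀ᶠ x in atTop, mon d x * x ≤ mon d₀ x := by
    intro d hd
    obtain ⟨hne, hd⟩ := Finset.mem_erase.mp hd
    filter_upwards [hf 0, hf (d 0 + 1), eventually_ge_atTop 1] with x hx0 hx1 hx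
    rw [pow_zero] at hx0
    have hfpos : 0 ≤ f x := zero_le_one.trans hx0
    rcases Prod.Lex.toLex_le_toLex.mp (hmax d hd) with hlt | ⟨heq, hle⟩
    · calc mon d x * x = x ^ (d 0 + 1) * f x ^ d 1 := by simp only [hmon]; ring
        _ ≤ f x * f x ^ d 1 := by gcongr
        _ = f x ^ (d 1 + 1) := by ring
        _ ≤ f x ^ d₀ 1 := pow_le_pow_right₀ hx0 hlt
        _ ≤ mon d₀ x := le_mul_of_one_le_left (by positivity) (one_le_pow₀ hx)
    · have hlt : d 0 < d₀ 0 := by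
        refine lt_of_le_of_ne hle fun h => hne ?_
        ext i
        fin_cases i
        · exact h
        · exact heq
      calc mon d x * x = x ^ (d 0 + 1) * f x ^ d 1 := by simp only [hmon]; ring
        _ ≤ x ^ d₀ 0 * f x ^ d 1 := by
          gcongr
          exact hlt
        _ = mon d₀ x := by
          have heq' : d 1 = d₀ 1 := heq
          simp only [hmon, heq']
  have hc : 0 < ‖P.coeff d₀‖ := norm_pos_iff.mpr (MvPolynomial.mem_support_iff.mp hd₀)
  set C : ℝ := ∑ d ∈ P.support.erase d₀, ‖P.coeff d‖ with hC
  obtain ⟨x, hx1, hx, hfx, hlarge⟩ := (((eventually_all_finset _).mpr hdom).and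
    ((eventually_ge_atTop 1).and ((hf 0).and (eventually_gt_atTop (C / ‖P.coeff d₀‖))))).exists
  rw [pow_zero] at hfx
  have hxpos : 0 < x := by linarith
  have hmonpos : ∀ d, 0 < mon d x := fun d => by
    have : 0 < f x := by linarith
    simp only [hmon]
    positivity
  have heval := hP x
  rw [MvPolynomial.eval_eq', ← Finset.add_sum_erase _ _ hd₀, add_eq_zero_iff_eq_neg] at heval
  have hnorm : ∀ d : Fin 2 →₀ ℕ,
      ‖P.coeff d * ∏ i, (![(x : ℂ), (f x : ℂ)] i) ^ d i‖ = ‖P.coeff d‖ * mon d x := by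
    intro d
    rw [norm_mul, Fin.prod_univ_two]
    simp [hmon, abs_of_pos hxpos, abs_of_nonneg (zero_le_one.trans hfx)]
  have hle : ‖P.coeff d₀‖ * mon d₀ x * x ≤ C * mon d₀ x := by
    rw [← hnorm, heval, norm_neg]
    calc _ ≤ (∑ d ∈ P.support.erase d₀, ‖P.coeff d‖ * mon d x) * x := by
          gcongr
          exact (norm_sum_le _ _).trans (Finset.sum_le_sum fun d _ => (hnorm d).le)
      _ = ∑ d ∈ P.support.erase d₀, ‖P.coeff d‖ * (mon d x * x) := by
          rw [Finset.sum_mul]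
          exact Finset.sum_congr rfl fun d _ => by ring
      _ ≤ ∑ d ∈ P.support.erase d₀, ‖P.coeff d‖ * mon d₀ x := by
          gcongr with d hd
          exact hx1 d hd
      _ = C * mon d₀ x := by rw [hC, Finset.sum_mul]
  rw [div_lt_iff₀ hc] at hlarge
  nlinarith [hmonpos d₀]

/-- A small perturbation of `B` by a multiple of `D` is a rational number of controlled
denominator, different from a prescribed value. -/
theorem exists_rational_perturbation (B v : ℝ) {δ D : ℝ} (hδ : 0 < δ) (hD : 0 < D) :
    ∃ t : ℝ, 0 < t ∧ t ≤ δ ∧ B + t * D ≠ v ∧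
      ∃ p q : ℤ, 1 < q ∧ (q : ℝ) ≤ 2 / (δ * D) + 2 ∧ B + t * D = p / q := by
  set q : ℤ := ⌈2 / (δ * D)⌉ + 1 with hq
  have hpos : 0 < 2 / (δ * D) := by positivity
  have hq1 : 1 < q := by
    have := Int.ceil_pos.mpr hpos
    omega
  have hq0 : (0 : ℝ) < q := by exact_mod_cast zero_lt_one.trans hq1
  have hqle : (q : ℝ) ≤ 2 / (δ * D) + 2 := by
    rw [hq]
    push_cast
    linarith [Int.ceil_lt_add_one (2 / (δ * D))]
  have hqge : 2 ≤ q * (δ * D) := by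
    rw [← div_le_iff₀ (by positivity), hq]
    push_cast
    linarith [Int.le_ceil (2 / (δ * D))]
  obtain ⟨p, hp1, hp2, hpv⟩ : ∃ p : ℤ, q * B < p ∧ (p : ℝ) ≤ q * B + 2 ∧ (p / q : ℝ) ≠ v := by
    have h1 := Int.lt_floor_add_one ((q : ℝ) * B)
    have h2 := Int.floor_le ((q : ℝ) * B)
    by_cases h : ((⌊(q : ℝ) * B⌋ + 1 : ℤ) / q : ℝ) = v
    · refine ⟨⌊(q : ℝ) * B⌋ + 2, by push_cast; linarith, by push_cast; linarith, ?_⟩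
      rw [← h]
      intro h'
      rw [div_left_inj' hq0.ne'] at h'
      push_cast at h'
      linarith
    · exact ⟨⌊(q : ℝ) * B⌋ + 1, by push_cast; linarith, by push_cast; linarith, h⟩
  have hval : B + (p / q - B) / D * D = p / q := by
    field_simp
    ring
  refine ⟨(p / q - B) / D, ?_, ?_, by rwa [hval], p, q, hq1, hqle, hval⟩
  · refine div_pos (sub_pos.mpr ?_) hD
    rw [lt_div_iff₀ hq0]
    linarith
  · rw [div_le_iff₀ hD, sub_le_iff_le_add, div_le_iff₀ hq0]
    linarith

/-- The Newton-type basis function `∏ i < n, (x - a i) ^ 2`. -/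
noncomputable def sqNode {R : Type*} [CommRing R] (a : ℕ → R) (n : ℕ) (x : R) : R :=
  ∏ i ∈ Finset.range n, (x - a i) ^ 2

theorem sqNode_eq_zero {a : ℕ → ℝ} {n k : ℕ} (h : n < k) : sqNode a k (a n) = 0 :=
  Finset.prod_eq_zero (Finset.mem_range.mpr h) (by simp)

theorem sqNode_nonneg (a : ℕ → ℝ) (n : ℕ) (x : ℝ) : 0 ≤ sqNode a n x :=
  Finset.prod_nonneg fun _ _ => sq_nonneg _

theorem sqNode_pos {a : ℕ → ℝ} (ha : Function.Injective a) (n : ℕ) : 0 < sqNode a n (a n) :=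
  Finset.prod_pos fun _ hi =>
    sq_pos_of_ne_zero (sub_ne_zero.mpr (ha.ne (Finset.mem_range.mp hi).ne'))

theorem norm_sqNode_le {a : ℕ → ℝ} {n : ℕ} {T R : ℝ} (hT1 : 1 ≤ T) (hT : ∀ i < n, |a i| ≤ T)
    {z : ℂ} (hz : ‖z‖ ≤ R) :
    ‖sqNode (fun i => (a i : ℂ)) n z‖ ≤ T ^ (2 * n) * ((R + 1) ^ 2) ^ n := by
  have hR : 0 ≤ R := (norm_nonneg z).trans hz
  rw [sqNode, norm_prod, pow_mul, ← mul_pow, ← mul_pow]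
  refine (Finset.prod_le_prod (fun i _ => norm_nonneg _) fun i hi => ?_).trans_eq
    (by rw [Finset.prod_const, Finset.card_range])
  rw [norm_pow]
  gcongr
  have := hT i (Finset.mem_range.mp hi)
  calc ‖z - (a i : ℂ)‖ ≤ ‖z‖ + ‖(a i : ℂ)‖ := norm_sub_le _ _
    _ ≤ R + T := by
      rw [Complex.norm_real, Real.norm_eq_abs]
      gcongr
    _ ≤ T * (R + 1) := by nlinarith

theorem eventually_pow_le_sqNode (a : ℕ → ℝ) (n : ℕ) :
    ∀ᶠ x in atTop, x ^ n ≤ sqNode a n x := by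
  have h : ∀ i ∈ Finset.range n, ∀ᶠ x in atTop, x ≤ (x - a i) ^ 2 := by
    intro i _
    filter_upwards [eventually_ge_atTop (2 * |a i| + 4)] with x hx
    have h1 := le_abs_self (a i)
    have h2 := abs_nonneg (a i)
    nlinarith [mul_nonneg (by linarith : 0 ≤ x - a i - x / 2) (by linarith : 0 ≤ x - a i + x / 2)]
  filter_upwards [(eventually_all_finset _).mpr h, eventually_ge_atTop 0] with x hx hx0
  calc x ^ n = ∏ i ∈ Finset.range n, x := by simp
    _ ≤ sqNode a n x := Finset.prod_le_prod (fun _ _ => hx0) hx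

/-- An entire function with positive coefficients in the basis `sqNode a`, taking rational
values of controlled denominator at the nodes `a n` and avoiding prescribed values there. -/
theorem exists_analytic_interpolation (a v T : ℕ → ℝ) (ha : Function.Injective a)
    (hT1 : ∀ n, 1 ≤ T n) (hT : ∀ n, ∀ i < n, |a i| ≤ T n) :
    ∃ φ : ℝ → ℝ, (∀ x, AnalyticAt ℝ φ x) ∧ (∀ N : ℕ, ∀ᶠ x in atTop, x ^ N ≤ φ x) ∧
      ∀ n, φ (a n) ≠ v n ∧ ∃ p q : ℤ, 1 < q ∧
        (q : ℝ) ≤ 2 / ((n.factorial * T n ^ (2 * n))⁻¹ * sqNode a n (a n)) + 2 ∧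
        φ (a n) = p / q := by
  set δ : ℕ → ℝ := fun n => (n.factorial * T n ^ (2 * n))⁻¹ with hδdef
  have hTpos : ∀ n, 0 < T n := fun n => zero_lt_one.trans_le (hT1 n)
  have hδ : ∀ n, 0 < δ n := fun n => by
    have := hTpos n
    simp only [hδdef]
    positivity
  choose t ht0 htδ htv htq using fun (n : ℕ) (B : ℝ) =>
    exists_rational_perturbation B (v n) (hδ n) (sqNode_pos ha n)
  let F : ℕ → ℝ → ℝ := Nat.rec 0 fun n G x => G x + t n (G (a n)) * sqNode a n x
  let c : ℕ → ℝ := fun n => t n (F n (a n))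
  have hF : ∀ n x, F n x = ∑ k ∈ Finset.range n, c k * sqNode a k x := by
    intro n x
    induction n with
    | zero => rfl
    | succ n ih => rw [Finset.sum_range_succ, ← ih]
  have hbound : ∀ (R : ℝ) (n : ℕ) (z : ℂ), ‖z‖ ≤ R →
      ‖(c n : ℂ) * sqNode (fun i => (a i : ℂ)) n z‖ ≤ ((R + 1) ^ 2) ^ n / n.factorial := by
    intro R n z hz
    have := hTpos n
    rw [norm_mul, Complex.norm_real, Real.norm_eq_abs, abs_of_pos (ht0 n _)]
    calc c n * ‖sqNode (fun i => (a i : ℂ)) n z‖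
        ≤ δ n * (T n ^ (2 * n) * ((R + 1) ^ 2) ^ n) := by
          gcongr
          · exact htδ n _
          · exact norm_sqNode_le (hT1 n) (hT n) hz
      _ = ((R + 1) ^ 2) ^ n / n.factorial := by
          simp only [hδdef]
          field_simp
  let Φ : ℂ → ℂ := fun z => ∑' n, (c n : ℂ) * sqNode (fun i => (a i : ℂ)) n z
  have hdiff : Differentiable ℂ Φ := by
    intro z
    have : DifferentiableOn ℂ Φ (Metric.ball 0 (‖z‖ + 1)) := by
      refine Complex.differentiableOn_tsum_of_summable_norm
        (Real.summable_pow_div_factorial ((‖z‖ + 1 + 1) ^ 2)) (fun n => ?_) Metric.isOpen_ball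
        fun n w hw => hbound (‖z‖ + 1) n w (mem_ball_zero_iff.mp hw).le
      unfold sqNode
      fun_prop
    exact this.differentiableAt (Metric.isOpen_ball.mem_nhds (by simp))
  let φ : ℝ → ℝ := fun x => ∑' n, c n * sqNode a n x
  have hcast : ∀ x : ℝ, Φ x = φ x := by
    intro x
    simp only [Φ, φ, sqNode]
    push_cast
    rfl
  have hsummable : ∀ x : ℝ, Summable fun n => c n * sqNode a n x := by
    intro x
    refine Summable.of_norm_bounded (Real.summable_pow_div_factorial ((|x| + 1) ^ 2)) fun n => ?_
    have := hbound |x| n x (by simp)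
    rw [← Complex.norm_real]
    convert this using 2
    simp [sqNode]
  have hnonneg : ∀ n x, 0 ≤ c n * sqNode a n x := fun n x =>
    mul_nonneg (ht0 n _).le (sqNode_nonneg a n x)
  have hval : ∀ n, φ (a n) = F n (a n) + c n * sqNode a n (a n) := by
    intro n
    rw [hF]
    refine (tsum_eq_sum fun k hk => ?_).trans (Finset.sum_range_succ _ n)
    rw [sqNode_eq_zero (by rw [Finset.mem_range] at hk; omega), mul_zero]
  refine ⟨φ, fun x => ?_, fun N => ?_, fun n => ?_⟩
  · have := (hdiff.analyticAt (x : ℂ)).re_ofReal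
    simpa only [hcast, Complex.ofReal_re] using this
  · have hc : 0 < c (N + 1) := ht0 _ _
    filter_upwards [eventually_pow_le_sqNode a (N + 1), eventually_ge_atTop (c (N + 1))⁻¹]
      with x hx hx'
    have hx0 : 0 ≤ x := (inv_pos.mpr hc).le.trans hx'
    have h1 : 1 ≤ c (N + 1) * x := by rwa [inv_le_iff_one_le_mul₀' hc] at hx'
    calc x ^ N ≤ c (N + 1) * x * x ^ N := le_mul_of_one_le_left (by positivity) h1
      _ = c (N + 1) * x ^ (N + 1) := by ring
      _ ≤ c (N + 1) * sqNode a (N + 1) x := by gcongr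
      _ ≤ φ x := (hsummable x).le_tsum (N + 1) fun k _ => hnonneg k x
  · rw [hval]
    exact ⟨htv n _, htq n _⟩

theorem infinite_algSet {m : ℕ} (hm : 1 ≤ m) : (algSet m).Infinite := by
  refine Set.infinite_of_injective_forall_mem (f := fun n : ℕ => (n : ℝ)) Nat.cast_injective
    fun n => ⟨isAlgebraic_natCast n, ?_⟩
  have := minpoly.eq_X_sub_C (A := ℚ) ℝ (n : ℚ)
  rw [map_natCast] at this
  rwa [this, natDegree_X_sub_C]

/-- The real algebraic numbers of degree at most `m` can be listed by nondecreasing height. -/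
theorem exists_enumeration_algSet {m : ℕ} (hm : 1 ≤ m) :
    ∃ a : ℕ → ℝ, Function.Injective a ∧ Set.range a = algSet m ∧
      Monotone fun n => algHeight (a n) := by
  let key : ℝ → ℕ ×ₗ ℝ := fun α => toLex (algHeight α, α)
  have hkey : Function.Injective key := fun α β h => congrArg Prod.snd (toLex_inj.mp h)
  let below : ℝ → Set ℝ := fun α => {β | β ∈ algSet m ∧ key β < key α}
  have hfin : ∀ α, (below α).Finite := by
    intro α
    obtain ⟨s, hs, -⟩ := exists_finset_algSet m (algHeight α)
    refine s.finite_toSet.subset fun β hβ => hs β hβ.1 ?_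
    rcases Prod.Lex.toLex_lt_toLex.mp hβ.2 with h | h
    · exact h.le
    · exact h.1.le
  let κ : algSet m → ℕ := fun α => (below α).ncard
  have hκ : ∀ α β : algSet m, key α < key β → κ α < κ β := by
    intro α β h
    refine Set.ncard_lt_ncard ⟨fun γ hγ => ⟨hγ.1, hγ.2.trans h⟩, fun hsub => ?_⟩ (hfin β)
    exact lt_irrefl _ (hsub ⟨α.2, h⟩).2
  have hκ' : ∀ α β : algSet m, κ α ≤ κ β → key α ≤ key β := fun α β h =>
    not_lt.mp fun h' => (hκ β α h').not_ge h
  have hinj : Function.Injective κ := fun α β h =>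
    Subtype.ext (hkey (le_antisymm (hκ' α β h.le) (hκ' β α h.ge)))
  have : Infinite (algSet m) := (infinite_algSet hm).to_subtype
  have : Infinite (Set.range κ) := (Set.infinite_range_of_injective hinj).to_subtype
  let e := Nat.Subtype.orderIsoOfNat (Set.range κ)
  let E := Equiv.ofInjective κ hinj
  refine ⟨fun n => E.symm (e n), fun i j h => ?_, ?_, fun i j h => ?_⟩
  · exact e.injective (E.symm.injective (Subtype.ext h))
  · ext α
    refine ⟨?_, fun hα => ⟨e.symm (E ⟨α, hα⟩), by simp⟩⟩
    rintro ⟨n, rfl⟩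
    exact (E.symm (e n)).2
  · have hle : κ (E.symm (e i)) ≤ κ (E.symm (e j)) := by
      have hE : ∀ x, κ (E.symm x) = x := fun x => congrArg Subtype.val (E.apply_symm_apply x)
      rw [hE, hE]
      exact e.monotone h
    exact Prod.Lex.monotone_fst _ _ (hκ' _ _ hle)

theorem two_le_expCube (x : ℝ) : 2 ≤ expCube x := by
  have h1 := Real.add_one_le_exp (Real.exp (Real.exp x))
  have h2 := Real.add_one_le_exp (Real.exp x)
  have h3 := Real.exp_pos x
  rw [expCube]
  linarith

theorem exists_le_expCube_pow (m L : ℕ) : ∃ K : ℕ, ∀ h n : ℕ, n ≤ (2 * h + 1) ^ (m + 1) * m →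
    4 * (n.factorial : ℝ) * (2 * (h : ℝ) + 2) ^ (L * n) ≤ expCube h ^ K := by
  set A : ℕ := 2 ^ (m + 1) * m with hA
  refine ⟨(3 + A ^ 2 + 2 * L * A) * (2 * m + 2).factorial, fun h n hn => ?_⟩
  set y := Real.exp h with hy
  have hhy : (h : ℝ) + 1 ≤ y := Real.add_one_le_exp _
  have hh0 : (0 : ℝ) ≤ h := h.cast_nonneg
  have hy1 : 1 ≤ y := by linarith
  set T : ℝ := 2 * h + 2 with hT
  have hTy : T ≤ 2 * y := by linarith
  have hT0 : 0 ≤ T := by positivity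
  have hny : (n : ℝ) ≤ A * y ^ (m + 1) := by
    calc (n : ℝ) ≤ (2 * h + 1) ^ (m + 1) * m := by exact_mod_cast hn
      _ ≤ (2 * y) ^ (m + 1) * m := by gcongr; linarith
      _ = A * y ^ (m + 1) := by rw [hA]; push_cast; ring
  have hfact : (n.factorial : ℝ) ≤ Real.exp (n * n) := by
    calc (n.factorial : ℝ) ≤ (n : ℝ) ^ n := by exact_mod_cast n.factorial_le_pow
      _ ≤ Real.exp n ^ n := by
        gcongr
        linarith [Real.add_one_le_exp (n : ℝ)]
      _ = Real.exp (n * n) := (Real.exp_nat_mul _ _).symm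
  have hpow : T ^ (L * n) ≤ Real.exp ((L * n : ℕ) * T) := by
    rw [Real.exp_nat_mul]
    gcongr
    linarith [Real.add_one_le_exp T]
  have hfour : (4 : ℝ) ≤ Real.exp 3 := by linarith [Real.add_one_le_exp (3 : ℝ)]
  have hexponent : 3 + (n : ℝ) * n + (L * n : ℕ) * T ≤
      ((3 + A ^ 2 + 2 * L * A) * (2 * m + 2).factorial : ℕ) * Real.exp y := by
    have h1 : (3 : ℝ) ≤ 3 * y ^ (2 * m + 2) := by linarith [one_le_pow₀ (n := 2 * m + 2) hy1]
    have h2 : (n : ℝ) * n ≤ A ^ 2 * y ^ (2 * m + 2) := by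
      calc (n : ℝ) * n ≤ (A * y ^ (m + 1)) * (A * y ^ (m + 1)) := by gcongr
        _ = A ^ 2 * y ^ (2 * m + 2) := by ring
    have h3 : ((L * n : ℕ) : ℝ) * T ≤ 2 * L * A * y ^ (2 * m + 2) := by
      push_cast
      calc (L : ℝ) * n * T ≤ L * (A * y ^ (m + 1)) * (2 * y) := by gcongr
        _ = 2 * L * A * y ^ (m + 2) := by ring
        _ ≤ 2 * L * A * y ^ (2 * m + 2) := by
          gcongr
          omega
    have h4 : y ^ (2 * m + 2) ≤ (2 * m + 2).factorial * Real.exp y := by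
      have := Real.pow_div_factorial_le_exp y (by linarith) (2 * m + 2)
      rwa [div_le_iff₀' (by positivity)] at this
    calc 3 + (n : ℝ) * n + (L * n : ℕ) * T
        ≤ (3 + A ^ 2 + 2 * L * A) * y ^ (2 * m + 2) := by linarith
      _ ≤ (3 + A ^ 2 + 2 * L * A) * ((2 * m + 2).factorial * Real.exp y) := by gcongr
      _ = _ := by push_cast; ring
  calc 4 * (n.factorial : ℝ) * T ^ (L * n)
      ≤ Real.exp 3 * Real.exp (n * n) * Real.exp ((L * n : ℕ) * T) := by gcongr
    _ = Real.exp (3 + (n : ℝ) * n + (L * n : ℕ) * T) := by rw [← Real.exp_add, ← Real.exp_add]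
    _ ≤ Real.exp _ := Real.exp_le_exp.mpr hexponent
    _ = expCube h ^ _ := by rw [Real.exp_nat_mul, expCube]

theorem liouville_of_isMUltra {m K : ℕ} {φ : ℝ → ℝ} (hφ : ∀ x, AnalyticAt ℝ φ x)
    (hgrowth : ∀ N : ℕ, ∀ᶠ x in atTop, x ^ N ≤ φ x)
    (hrat : ∀ α ∈ algSet m, ∃ p q : ℤ, 1 < q ∧ (q : ℝ) ≤ expCube (algHeight α) ^ K ∧
      φ α = p / q) {ξ : ℝ} (hξ : IsMUltra m ξ) : Liouville (φ ξ) := by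
  obtain ⟨a, -, ha⟩ := hξ
  have hlim : Tendsto a atTop (𝓝[≠] ξ) := by
    refine tendsto_nhdsWithin_iff.mpr ⟨?_, Eventually.of_forall fun k h => ?_⟩
    · rw [tendsto_iff_dist_tendsto_zero]
      refine squeeze_zero (fun _ => dist_nonneg) (fun k => ?_)
        ((tendsto_pow_atTop_nhds_zero_of_lt_one (by norm_num) (by norm_num :
          (2⁻¹ : ℝ) < 1)).comp (tendsto_add_atTop_nat 1))
      rw [dist_comm, Real.dist_eq]
      refine (ha k).2.2.le.trans ?_
      have := two_le_expCube (algHeight (a k))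
      simp only [Function.comp_apply]
      gcongr
    · have := (ha k).2.1
      simp only [Set.mem_singleton_iff] at h
      simp [h] at this
  have hne : ∀ᶠ k in atTop, φ (a k) ≠ φ ξ := by
    refine hlim.eventually (((hφ ξ).eventually_eq_or_eventually_ne
      (analyticAt_const (v := φ ξ))).resolve_left fun h => ?_)
    have heq : φ = fun _ => φ ξ :=
      AnalyticOnNhd.eq_of_eventuallyEq (fun x _ => hφ x) analyticOnNhd_const h
    obtain ⟨x, hx, hx'⟩ := ((hgrowth 1).and (eventually_gt_atTop (φ ξ))).exists
    rw [heq] at hx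
    simp only [pow_one] at hx
    exact hx'.not_ge hx
  obtain ⟨C, hC⟩ := (hφ ξ).differentiableAt.isBigO_sub.bound
  have hC' := (hlim.mono_right nhdsWithin_le_nhds).eventually hC
  obtain ⟨L, hL⟩ := pow_unbounded_of_one_lt C (one_lt_two : (1 : ℝ) < 2)
  intro n
  obtain ⟨k, hk, hkne, hkC⟩ := ((eventually_ge_atTop (K * n + L)).and (hne.and hC')).exists
  obtain ⟨hdeg, hpos, hlt⟩ := ha k
  obtain ⟨p, q, hq, hqle, hval⟩ := hrat (a k) ⟨hdeg.1, hdeg.2.le⟩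
  refine ⟨p, q, hq, by rw [← hval]; exact hkne.symm, ?_⟩
  have hE := two_le_expCube (algHeight (a k))
  set E := expCube (algHeight (a k))
  have hq0 : (0 : ℝ) < q := by exact_mod_cast zero_lt_one.trans hq
  have hlarge : 2 ^ L * (q : ℝ) ^ n ≤ E ^ (k + 1) := by
    calc 2 ^ L * (q : ℝ) ^ n ≤ E ^ L * (E ^ K) ^ n := by gcongr
      _ = E ^ (K * n + L) := by rw [← pow_mul, ← pow_add, add_comm]
      _ ≤ E ^ (k + 1) := pow_le_pow_right₀ (by linarith) (by omega)
  rw [← hval, abs_sub_comm, lt_div_iff₀ (by positivity)]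
  simp only [Real.norm_eq_abs] at hkC
  rw [abs_sub_comm (a k)] at hkC
  rw [inv_pow, lt_inv_comm₀ hpos (by positivity)] at hlt
  calc |φ (a k) - φ ξ| * (q : ℝ) ^ n ≤ C * |ξ - a k| * q ^ n := by gcongr
    _ ≤ 2 ^ L * |ξ - a k| * q ^ n := by gcongr
    _ = |ξ - a k| * (2 ^ L * q ^ n) := by ring
    _ ≤ |ξ - a k| * E ^ (k + 1) := by gcongr
    _ < |ξ - a k| * |ξ - a k|⁻¹ := by gcongr
    _ = 1 := mul_inv_cancel₀ hpos.ne'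

/-- The denominators produced by interpolation at the algebraic numbers, listed by height,
are bounded by a power of `expCube`. -/
theorem exists_denominator_bound {m : ℕ} {a : ℕ → ℝ} (ha : Function.Injective a)
    (hmem : ∀ n, a n ∈ algSet m) (hmono : Monotone fun n => algHeight (a n)) :
    ∃ K : ℕ, ∀ n, 2 / ((n.factorial * (2 * (algHeight (a n) : ℝ) + 2) ^ (2 * n))⁻¹ *
      sqNode a n (a n)) + 2 ≤ expCube (algHeight (a n)) ^ K := by
  set k := 3 * (m ^ 2 + 1) with hk
  obtain ⟨K, hK⟩ := exists_le_expCube_pow m (2 * k + 2)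
  refine ⟨K, fun n => ?_⟩
  set H := algHeight (a n) with hH
  have hn : n ≤ (2 * H + 1) ^ (m + 1) * m := by
    obtain ⟨s, hs, hcard⟩ := exists_finset_algSet m H
    refine le_trans ?_ hcard
    rw [← Finset.card_range n]
    exact Finset.card_le_card_of_injOn a
      (fun i hi => hs _ (hmem i) (hmono (Finset.mem_range.mp hi).le)) ha.injOn
  refine le_trans ?_ (hK H n hn)
  set T : ℝ := 2 * H + 2 with hT
  have hT1 : 1 ≤ T := by
    have : (0 : ℝ) ≤ H := H.cast_nonneg
    linarith
  have hS := sqNode_pos ha n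
  have hsep : 1 ≤ sqNode a n (a n) * T ^ (2 * k * n) := by
    have : T ^ (2 * k * n) = ∏ i ∈ Finset.range n, T ^ (2 * k) := by
      rw [Finset.prod_const, Finset.card_range, pow_mul]
    rw [this, sqNode, ← Finset.prod_mul_distrib]
    rw [← Finset.prod_const_one (s := Finset.range n)]
    refine Finset.prod_le_prod (fun _ _ => zero_le_one) fun i hi => ?_
    have hi := Finset.mem_range.mp hi
    have h1 := one_le_abs_sub_mul_pow (hmem n) (hmem i) (ha.ne hi.ne') le_rfl (hmono hi.le)
    calc (1 : ℝ) ≤ (|a n - a i| * T ^ k) ^ 2 := one_le_pow₀ h1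
      _ = (a n - a i) ^ 2 * T ^ (2 * k) := by rw [mul_pow, sq_abs, ← pow_mul, mul_comm k]
  have hfact : (1 : ℝ) ≤ n.factorial := by exact_mod_cast n.factorial_pos
  have hmain : 2 / ((n.factorial * T ^ (2 * n))⁻¹ * sqNode a n (a n)) ≤
      2 * (n.factorial : ℝ) * T ^ ((2 * k + 2) * n) := by
    rw [div_le_iff₀ (by positivity)]
    calc (2 : ℝ) ≤ 2 * (sqNode a n (a n) * T ^ (2 * k * n)) := by linarith
      _ = _ := by
        rw [add_mul, pow_add]
        field_simp
  have hone : 1 ≤ (n.factorial : ℝ) * T ^ ((2 * k + 2) * n) :=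
    one_le_mul_of_one_le_of_one_le hfact (one_le_pow₀ hT1)
  linarith

/-- There exist uncountably many transcendental real-analytic functions `φ : ℝ → ℝ`
mapping every `m`-ultra number to a Liouville number. -/
theorem stmt_0 (m : ℕ) (hm : 1 ≤ m) :
    ∃ S : Set (ℝ → ℝ), ¬ S.Countable ∧ ∀ φ ∈ S,
      (∀ x : ℝ, AnalyticAt ℝ φ x) ∧ TranscendentalFun φ ∧
      ∀ ξ : ℝ, IsMUltra m ξ → Liouville (φ ξ) := by
  obtain ⟨a, ha, hrange, hmono⟩ := exists_enumeration_algSet hm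
  have hmem : ∀ n, a n ∈ algSet m := fun n => hrange ▸ Set.mem_range_self n
  obtain ⟨K, hK⟩ := exists_denominator_bound ha hmem hmono
  refine ⟨{φ | (∀ x : ℝ, AnalyticAt ℝ φ x) ∧ TranscendentalFun φ ∧
    ∀ ξ : ℝ, IsMUltra m ξ → Liouville (φ ξ)}, fun hcount => ?_, fun φ hφ => hφ⟩
  obtain ⟨f, hf⟩ := Set.countable_iff_exists_subset_range.mp hcount
  obtain ⟨φ, hφ, hgrowth, hval⟩ := exists_analytic_interpolation a (fun n => f n (a n))
    (fun n => 2 * algHeight (a n) + 2) ha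
    (fun n => by linarith [(algHeight (a n)).cast_nonneg (α := ℝ)])
    (fun n i hi => by
      have h1 := abs_le_algHeight_add_one (hmem i).1
      have h2 : (algHeight (a i) : ℝ) ≤ algHeight (a n) := by exact_mod_cast hmono hi.le
      linarith [(algHeight (a n)).cast_nonneg (α := ℝ)])
  obtain ⟨n, hn⟩ := hf ⟨hφ, transcendentalFun_of_growth hgrowth, fun ξ hξ =>
    liouville_of_isMUltra (K := K) hφ hgrowth (fun α hα => by
      obtain ⟨n, rfl⟩ := hrange ▸ hα
      obtain ⟨-, p, q, hq, hle, heq⟩ := hval n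
      exact ⟨p, q, hq, hle.trans (hK n), heq⟩) hξ⟩
  exact (hval n).1 (by rw [hn])
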